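/- Let (P_i)_{i ∈ I} be a family of quasiexact dcpos such that for all but finitely many i ∈ I the poset P_i has a least element. Then the cartesian product ∏_{i ∈ I} P_i, equipped with the componentwise order, is a quasiexact dcpo. -/

import Mathlib

open Set TopologicalSpace

variable {α : Type*}

/-- The upper closure `↑A = {p : ∃ a ∈ A, a ≤ p}`. -/
def upSet [PartialOrder α] (A : Set α) : Set α := {p | ∃ a ∈ A, a ≤ p}

/-- The lower closure `↓A = {p : ∃ a ∈ A, p ≤ a}`. -/
def downSet [PartialOrder α] (A : Set α) : Set α := {p | ∃ a ∈ A, p ≤ a}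

/-- A nonempty subset `D` is directed if every two elements have an upper bound in `D`. -/
def IsDirectedSet [PartialOrder α] (D : Set α) : Prop :=
  D.Nonempty ∧ ∀ a ∈ D, ∀ b ∈ D, ∃ c ∈ D, a ≤ c ∧ b ≤ c

/-- `G` is weakly way below `H` (`G ≪_w H`): for every directed `D` whose sup exists,
`sup D ∈ H` implies `d ∈ ↑G` for some `d ∈ D`. -/
def WWB [PartialOrder α] (G H : Set α) : Prop :=
  ∀ D : Set α, IsDirectedSet D → ∀ s : α, IsLUB D s → s ∈ H → ∃ d ∈ D, d ∈ upSet G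

/-- `↟_w G = {a : G ≪_w a}`. -/
def wUp [PartialOrder α] (G : Set α) : Set α := {a | WWB G {a}}

/-- `fin_w(x)`: all finite nonempty subsets `F` with `F ≪_w x`. -/
def finW [PartialOrder α] (x : α) : Set (Set α) :=
  {F | F.Finite ∧ F.Nonempty ∧ WWB F {x}}

/-- `fin_(bl)w(x) = {F ∈ fin_w(x) : F ⊆ ↓x}`. -/
def finBlW [PartialOrder α] (x : α) : Set (Set α) :=
  {F | F ∈ finW x ∧ F ⊆ downSet {x}}

/-- A family `𝓕` of subsets is directed if for `F₁, F₂ ∈ 𝓕` there is `F₃ ∈ 𝓕`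
with `F₃ ⊆ ↑F₁ ∩ ↑F₂`. -/
def DirectedFam [PartialOrder α] (𝓕 : Set (Set α)) : Prop :=
  ∀ F₁ ∈ 𝓕, ∀ F₂ ∈ 𝓕, ∃ F₃ ∈ 𝓕, F₃ ⊆ upSet F₁ ∩ upSet F₂

/-- `P` is quasiexact if for each `x` the family `fin_w(x)` is directed and
`⋂ {↑F : F ∈ fin_w(x)} = ↑x`. -/
def Quasiexact (α : Type*) [PartialOrder α] : Prop :=
  ∀ x : α, DirectedFam (finW x) ∧ (⋂ F ∈ finW x, upSet F) = upSet {x}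

/-- A dcpo: every directed subset has a supremum. -/
def IsDcpo (α : Type*) [PartialOrder α] : Prop :=
  ∀ D : Set α, IsDirectedSet D → ∃ s : α, IsLUB D s

/-- The wf topology: generated by the subbasis `{↟_w F : F finite nonempty}`. -/
def wfTopology (α : Type*) [PartialOrder α] : TopologicalSpace α :=
  generateFrom {U | ∃ F : Set α, F.Finite ∧ F.Nonempty ∧ U = wUp F}

/-- The wwb topology: generated by the subbasis `{↟_w x : x ∈ P}`. -/
def wwbTopology (α : Type*) [PartialOrder α] : TopologicalSpace α :=
  generateFrom {U | ∃ x : α, U = wUp {x}}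

/-- `P` is moderately meet continuous: `x ≤ sup D` implies
`x ∈ cl_{τ_wf}(↓D ∩ ↓x)` for every directed `D` whose sup exists. -/
def ModMeetCont (α : Type*) [PartialOrder α] : Prop :=
  ∀ x : α, ∀ D : Set α, IsDirectedSet D → ∀ s : α, IsLUB D s → x ≤ s →
    x ∈ @closure α (wfTopology α) (downSet D ∩ downSet {x})

/-- `U` is Scott open: `U = ↑U` and every directed set whose sup lies in `U` meets `U`. -/
def IsScottOpen [PartialOrder α] (U : Set α) : Prop :=
  upSet U = U ∧
    ∀ D : Set α, IsDirectedSet D → ∀ s : α, IsLUB D s → s ∈ U → (D ∩ U).Nonempty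

/-- The Scott topology. -/
def scottTopology (α : Type*) [PartialOrder α] : TopologicalSpace α :=
  generateFrom {U | IsScottOpen U}

/-- `P` is exact: for every `x` the set `{y : y ≪_w x}` is directed with supremum `x`. -/
def ExactPoset (α : Type*) [PartialOrder α] : Prop :=
  ∀ x : α, IsDirectedSet {y | WWB {y} {x}} ∧ IsLUB {y | WWB {y} {x}} x

/-- `x` is way below `y`: for every directed `D` whose sup exists,
`y ≤ sup D` implies `x ≤ d` for some `d ∈ D`. -/
def WayBelowPt [PartialOrder α] (x y : α) : Prop :=
  ∀ D : Set α, IsDirectedSet D → ∀ s : α, IsLUB D s → y ≤ s → ∃ d ∈ D, x ≤ d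

/-- `G` is way below `H`: for every directed `D` whose sup exists,
`sup D ∈ ↑H` implies `d ∈ ↑G` for some `d ∈ D`. -/
def WayBelowSet [PartialOrder α] (G H : Set α) : Prop :=
  ∀ D : Set α, IsDirectedSet D → ∀ s : α, IsLUB D s → s ∈ upSet H → ∃ d ∈ D, d ∈ upSet G

/-- `fin(x)`: all finite nonempty subsets `F` with `F ≪ x`. -/
def finWB [PartialOrder α] (x : α) : Set (Set α) :=
  {F | F.Finite ∧ F.Nonempty ∧ WayBelowSet F {x}}

/-- The relation `≪_w` is weakly increasing: `x ≪_w y ≤ z ≪_w u` implies `x ≪_w z`. -/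
def WeaklyIncreasing (α : Type*) [PartialOrder α] : Prop :=
  ∀ x y z u : α, WWB {x} {y} → y ≤ z → WWB {z} {u} → WWB {x} {z}

theorem mem_upSet_of_wwb [PartialOrder α] {F : Set α} {x : α} (h : WWB F {x}) :
    x ∈ upSet F := by
  obtain ⟨d, rfl, hd⟩ := h {x} ⟨singleton_nonempty x, by simp⟩ x isLUB_singleton rfl
  exact hd

theorem inter_Iic_mem_finBlW [PartialOrder α] {F : Set α} {x : α} (h : F ∈ finW x) :
    F ∩ Iic x ∈ finBlW x := by
  obtain ⟨hf, -, hw⟩ := h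
  obtain ⟨a, ha, hax⟩ := mem_upSet_of_wwb hw
  refine ⟨⟨hf.inter_of_left _, ⟨a, ha, hax⟩, ?_⟩, fun y hy => ⟨x, rfl, hy.2⟩⟩
  rintro D hD s hs rfl
  obtain ⟨d, hd, f, hf, hfd⟩ := hw D hD s hs rfl
  exact ⟨d, hd, f, ⟨hf, hfd.trans (hs.1 hd)⟩, hfd⟩

theorem singleton_mem_finBlW_of_isBot [PartialOrder α] {b : α} (hb : IsBot b) (x : α) :
    {b} ∈ finBlW x := by
  refine ⟨⟨finite_singleton b, singleton_nonempty b, fun D hD _ _ _ => ?_⟩, ?_⟩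
  · obtain ⟨d, hd⟩ := hD.1
    exact ⟨d, hd, b, rfl, hb d⟩
  · rintro _ rfl
    exact ⟨x, rfl, hb x⟩

theorem Quasiexact.finBlW_nonempty [PartialOrder α] (h : Quasiexact α) (x : α) :
    (finBlW x).Nonempty := by
  by_cases hx : IsBot x
  · exact ⟨{x}, singleton_mem_finBlW_of_isBot hx x⟩
  · by_contra hne
    refine hx fun y => ?_
    have hy : y ∈ ⋂ F ∈ finW x, upSet F :=
      mem_iInter₂.2 fun F hF => (hne ⟨_, inter_Iic_mem_finBlW hF⟩).elim
    rw [(h x).2] at hy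
    obtain ⟨_, rfl, hxy⟩ := hy
    exact hxy

theorem Quasiexact.directedFam_finBlW [PartialOrder α] (h : Quasiexact α) (x : α) :
    DirectedFam (finBlW x) := by
  intro F₁ h₁ F₂ h₂
  obtain ⟨F, hF, hsub⟩ := (h x).1 F₁ h₁.1 F₂ h₂.1
  exact ⟨_, inter_Iic_mem_finBlW hF, inter_subset_left.trans hsub⟩

theorem Quasiexact.le_of_forall_finBlW [PartialOrder α] (h : Quasiexact α) {x y : α}
    (hy : ∀ F ∈ finBlW x, y ∈ upSet F) : x ≤ y := by
  have hmem : y ∈ ⋂ F ∈ finW x, upSet F := mem_iInter₂.2 fun F hF => by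
    obtain ⟨f, hf, hfy⟩ := hy _ (inter_Iic_mem_finBlW hF)
    exact ⟨f, hf.1, hfy⟩
  rw [(h x).2] at hmem
  obtain ⟨_, rfl, hxy⟩ := hmem
  exact hxy

theorem IsDirectedSet.exists_forall_le_of_finite [PartialOrder α] {D : Set α}
    (hD : IsDirectedSet D) {ι : Type*} {J : Set ι} (hJ : J.Finite) {d : ι → α}
    (hd : ∀ i ∈ J, d i ∈ D) : ∃ e ∈ D, ∀ i ∈ J, d i ≤ e := by
  induction J, hJ using Set.Finite.induction_on with
  | empty => exact hD.1.imp fun e he => ⟨he, by simp⟩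
  | @insert a J _ _ ih =>
    obtain ⟨e, he, hle⟩ := ih fun i hi => hd i (mem_insert_of_mem a hi)
    obtain ⟨c, hc, hac, hec⟩ := hD.2 _ (hd a (mem_insert a J)) e he
    refine ⟨c, hc, ?_⟩
    rintro i (rfl | hi)
    · exact hac
    · exact (hle i hi).trans hec

/-- Rudin's lemma: a lower set meeting every member of a directed family of finite sets contains
a directed set meeting every member. -/
theorem exists_isDirectedSet_of_directedFam [PartialOrder α] {𝓕 : Set (Set α)}
    (hne : 𝓕.Nonempty) (hfin : ∀ F ∈ 𝓕, F.Finite) (hdir : DirectedFam 𝓕)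
    {L : Set α} (hL : IsLowerSet L) (hmeet : ∀ F ∈ 𝓕, (F ∩ L).Nonempty) :
    ∃ D ⊆ L, IsDirectedSet D ∧ ∀ F ∈ 𝓕, (F ∩ D).Nonempty := by
  obtain ⟨C, hCL, ⟨hClow, hCmeet⟩, hCmin⟩ := zorn_superset_nonempty
    {C : Set α | IsLowerSet C ∧ ∀ F ∈ 𝓕, (F ∩ C).Nonempty} (fun c hc hchain hcne => by
      refine ⟨⋂₀ c, ⟨isLowerSet_sInter fun C hC => (hc hC).1, fun F hF => ?_⟩,
        fun C hC => sInter_subset_of_mem hC⟩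
      by_contra hempty
      have hmiss : ∀ f ∈ F, ∃ C ∈ c, f ∉ C := by
        intro f hf
        by_contra! hall
        exact hempty ⟨f, hf, mem_sInter.2 hall⟩
      choose! C hCc hCf using hmiss
      obtain ⟨A, hA, hAle⟩ := IsDirectedSet.exists_forall_le_of_finite (α := (Set α)ᵒᵈ)
        ⟨hcne, fun A hA B hB => (hchain.total hA hB).elim
          (fun hAB => ⟨A, hA, le_rfl, hAB⟩) (fun hBA => ⟨B, hB, hBA, le_rfl⟩)⟩
        (hfin F hF) hCc
      obtain ⟨f, hfF, hfA⟩ := (hc hA).2 F hF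
      exact hCf f hfF (hAle f hfF hfA)) L ⟨hL, hmeet⟩
  have key : ∀ a ∈ C, ∃ F ∈ 𝓕, ∀ f ∈ F, f ∈ C → a ≤ f := by
    intro a ha
    by_contra! hcon
    have hsub := hCmin (y := C \ Ici a)
      ⟨hClow.inter (isUpperSet_Ici a).compl, fun F hF => by
        obtain ⟨f, hf, hfC, hfa⟩ := hcon F hF
        exact ⟨f, hf, hfC, hfa⟩⟩ sdiff_subset
    exact (hsub ha).2 le_rfl
  refine ⟨C, hCL, ⟨?_, fun a ha b hb => ?_⟩, hCmeet⟩
  · obtain ⟨F, hF⟩ := hne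
    exact (hCmeet F hF).right
  · obtain ⟨A, hA, hAa⟩ := key a ha
    obtain ⟨B, hB, hBb⟩ := key b hb
    obtain ⟨F, hF, hFAB⟩ := hdir A hA B hB
    obtain ⟨c, hcF, hcC⟩ := hCmeet F hF
    obtain ⟨⟨u, hu, huc⟩, ⟨v, hv, hvc⟩⟩ := hFAB hcF
    exact ⟨c, hcC, (hAa u hu (hClow huc hcC)).trans huc, (hBb v hv (hClow hvc hcC)).trans hvc⟩

theorem exists_subset_upSet_of_wwb [PartialOrder α] (hα : IsDcpo α) {x : α} {𝓕 : Set (Set α)}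
    (hne : 𝓕.Nonempty) (h𝓕 : 𝓕 ⊆ finBlW x) (hdir : DirectedFam 𝓕)
    (hle : ∀ y, (∀ F ∈ 𝓕, y ∈ upSet F) → x ≤ y) {G : Set α} (hG : WWB G {x}) :
    ∃ F ∈ 𝓕, F ⊆ upSet G := by
  by_contra! hcon
  have hlow : IsLowerSet (Iic x \ upSet G) := by
    rintro a b hba ⟨hax, haG⟩
    exact ⟨hba.trans hax, fun ⟨g, hg, hgb⟩ => haG ⟨g, hg, hgb.trans hba⟩⟩
  obtain ⟨D, hDsub, hD, hDmeet⟩ := exists_isDirectedSet_of_directedFam hne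
    (fun F hF => (h𝓕 hF).1.1) hdir hlow (fun F hF => by
      obtain ⟨f, hf, hfG⟩ := not_subset.1 (hcon F hF)
      obtain ⟨_, rfl, hfx⟩ := (h𝓕 hF).2 hf
      exact ⟨f, hf, hfx, hfG⟩)
  obtain ⟨s, hs⟩ := hα D hD
  have hsx : s = x := le_antisymm (hs.2 fun d hd => (hDsub hd).1) <| hle s fun F hF => by
    obtain ⟨f, hf, hfD⟩ := hDmeet F hF
    exact ⟨f, hf, hs.1 hfD⟩
  obtain ⟨d, hd, hdG⟩ := hG D hD s hs hsx
  exact (hDsub hd).2 hdG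

/-- A dcpo is quasiexact as soon as every `x` has a directed subfamily of `finBlW x` whose upper
closures intersect in `↑x`. -/
theorem quasiexact_of_forall_exists_directedFam [PartialOrder α] (hα : IsDcpo α)
    (h : ∀ x : α, ∃ 𝓕 ⊆ finBlW x, 𝓕.Nonempty ∧ DirectedFam 𝓕 ∧
      ∀ y, (∀ F ∈ 𝓕, y ∈ upSet F) → x ≤ y) : Quasiexact α := by
  intro x
  obtain ⟨𝓕, h𝓕, hne, hdir, hle⟩ := h x
  refine ⟨fun G₁ h₁ G₂ h₂ => ?_, Subset.antisymm (fun y hy => ?_) ?_⟩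
  · obtain ⟨F₁, hF₁, hFG₁⟩ := exists_subset_upSet_of_wwb hα hne h𝓕 hdir hle h₁.2.2
    obtain ⟨F₂, hF₂, hFG₂⟩ := exists_subset_upSet_of_wwb hα hne h𝓕 hdir hle h₂.2.2
    obtain ⟨F, hF, hsub⟩ := hdir F₁ hF₁ F₂ hF₂
    refine ⟨F, (h𝓕 hF).1, fun f hf => ?_⟩
    obtain ⟨⟨u, hu, huf⟩, ⟨v, hv, hvf⟩⟩ := hsub hf
    obtain ⟨g, hg, hgu⟩ := hFG₁ hu
    obtain ⟨k, hk, hkv⟩ := hFG₂ hv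
    exact ⟨⟨g, hg, hgu.trans huf⟩, ⟨k, hk, hkv.trans hvf⟩⟩
  · exact ⟨x, rfl, hle y fun F hF => mem_iInter₂.1 hy F (h𝓕 hF).1⟩
  · rintro y ⟨_, rfl, hxy⟩
    refine mem_iInter₂.2 fun F hF => ?_
    obtain ⟨f, hf, hfx⟩ := mem_upSet_of_wwb hF.2.2
    exact ⟨f, hf, hfx.trans hxy⟩

theorem IsDirectedSet.image_eval {ι : Type*} {P : ι → Type*} [∀ i, PartialOrder (P i)]
    {D : Set (∀ i, P i)} (hD : IsDirectedSet D) (i : ι) :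
    IsDirectedSet (Function.eval i '' D) := by
  refine ⟨hD.1.image _, ?_⟩
  rintro _ ⟨a, ha, rfl⟩ _ ⟨b, hb, rfl⟩
  obtain ⟨c, hc, hac, hbc⟩ := hD.2 a ha b hb
  exact ⟨c i, ⟨c, hc, rfl⟩, hac i, hbc i⟩

theorem IsDcpo.pi {ι : Type*} {P : ι → Type*} [∀ i, PartialOrder (P i)]
    (hP : ∀ i, IsDcpo (P i)) : IsDcpo (∀ i, P i) := by
  intro D hD
  choose s hs using fun i => hP i _ (hD.image_eval i)
  exact ⟨s, isLUB_pi.2 hs⟩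

theorem finite_univ_pi_of_finite_not_subsingleton {ι : Type*} {P : ι → Type*}
    {T : ∀ i, Set (P i)} (hT : ∀ i, (T i).Finite) (h : {i | ¬ (T i).Subsingleton}.Finite) :
    (univ.pi T).Finite := by
  have := h.to_subtype
  let r : (∀ i, P i) → ∀ j : {i | ¬ (T i).Subsingleton}, P j := fun f j => f j
  have hfin : {g : ∀ j : {i | ¬ (T i).Subsingleton}, P j | ∀ j, g j ∈ T j.1}.Finite :=
    Set.Finite.pi' fun j => hT j.1
  refine Set.Finite.of_finite_image (f := r) (hfin.subset ?_) ?_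
  · rintro _ ⟨f, hf, rfl⟩ j
    exact hf j trivial
  · intro f hf g hg hfg
    funext i
    by_cases hi : (T i).Subsingleton
    · exact hi (hf i trivial) (hg i trivial)
    · exact congrFun hfg ⟨i, hi⟩

/-- `S` consists of a least element only. -/
def IsBotSingleton [PartialOrder α] (S : Set α) : Prop := ∃ b, S = {b} ∧ IsBot b

/-- The boxes `∏ T i` with `T i ∈ finBlW (x i)`, where all but finitely many `T i` are `{⊥}`. -/
def finBlWBoxes {ι : Type*} {P : ι → Type*} [∀ i, PartialOrder (P i)] (x : ∀ i, P i) :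
    Set (Set (∀ i, P i)) :=
  {S | ∃ T : ∀ i, Set (P i), (∀ i, T i ∈ finBlW (x i)) ∧
    {i | ¬ IsBotSingleton (T i)}.Finite ∧ S = univ.pi T}

section Boxes

variable {ι : Type*} {P : ι → Type*} [∀ i, PartialOrder (P i)]

theorem mem_upSet_univ_pi {T : ∀ i, Set (P i)} {y : ∀ i, P i} :
    y ∈ upSet (univ.pi T) ↔ ∀ i, y i ∈ upSet (T i) := by
  constructor
  · rintro ⟨f, hf, hfy⟩ i
    exact ⟨f i, hf i trivial, hfy i⟩
  · intro h
    choose f hf hfy using h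
    exact ⟨f, fun i _ => hf i, hfy⟩

theorem finBlWBoxes_subset_finBlW (x : ∀ i, P i) : finBlWBoxes x ⊆ finBlW x := by
  rintro _ ⟨T, hT, hJ, rfl⟩
  refine ⟨⟨?_, univ_pi_nonempty_iff.2 fun i => (hT i).1.2.1, ?_⟩, fun f hf => ?_⟩
  · refine finite_univ_pi_of_finite_not_subsingleton (fun i => (hT i).1.1)
      (hJ.subset fun i hi hb => hi ?_)
    obtain ⟨b, hb, -⟩ := hb
    exact hb ▸ subsingleton_singleton
  · rintro D hD s hs rfl
    have hmem : ∀ i, ∃ d ∈ D, d i ∈ upSet (T i) := by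
      intro i
      obtain ⟨_, ⟨d, hd, rfl⟩, hdT⟩ :=
        (hT i).1.2.2 _ (hD.image_eval i) (s i) (isLUB_pi.1 hs i) rfl
      exact ⟨d, hd, hdT⟩
    choose d hd hdT using hmem
    obtain ⟨e, he, hle⟩ := hD.exists_forall_le_of_finite hJ fun i _ => hd i
    refine ⟨e, he, mem_upSet_univ_pi.2 fun i => ?_⟩
    by_cases hi : IsBotSingleton (T i)
    · obtain ⟨b, hb, hbot⟩ := hi
      exact ⟨b, hb ▸ rfl, hbot _⟩
    · obtain ⟨t, ht, htd⟩ := hdT i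
      exact ⟨t, ht, htd.trans (hle i hi i)⟩
  · refine ⟨x, rfl, fun i => ?_⟩
    obtain ⟨_, rfl, hle⟩ := (hT i).2 (hf i trivial)
    exact hle

theorem directedFam_finBlWBoxes (hq : ∀ i, Quasiexact (P i)) (x : ∀ i, P i) :
    DirectedFam (finBlWBoxes x) := by
  rintro _ ⟨T₁, hT₁, hJ₁, rfl⟩ _ ⟨T₂, hT₂, hJ₂, rfl⟩
  have hT : ∀ i, ∃ S ∈ finBlW (x i), S ⊆ upSet (T₁ i) ∩ upSet (T₂ i) ∧
      (IsBotSingleton (T₁ i) → IsBotSingleton (T₂ i) → IsBotSingleton S) := by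
    intro i
    by_cases h : IsBotSingleton (T₁ i) ∧ IsBotSingleton (T₂ i)
    · obtain ⟨⟨b, hb, hbot⟩, ⟨c, hc, hcbot⟩⟩ := h
      exact ⟨T₁ i, hT₁ i, fun y hy => ⟨⟨y, hy, le_rfl⟩, ⟨c, hc ▸ rfl, hcbot y⟩⟩,
        fun h _ => h⟩
    · obtain ⟨S, hS, hsub⟩ := (hq i).directedFam_finBlW (x i) _ (hT₁ i) _ (hT₂ i)
      exact ⟨S, hS, hsub, fun h₁ h₂ => (h ⟨h₁, h₂⟩).elim⟩
  choose T hT hsub hbot using hT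
  refine ⟨_, ⟨T, hT, (hJ₁.union hJ₂).subset fun i hi => ?_, rfl⟩, fun f hf =>
    ⟨mem_upSet_univ_pi.2 fun i => (hsub i (hf i trivial)).1,
      mem_upSet_univ_pi.2 fun i => (hsub i (hf i trivial)).2⟩⟩
  by_contra hcon
  rw [mem_union, not_or] at hcon
  exact hi (hbot i (not_not.1 hcon.1) (not_not.1 hcon.2))

theorem exists_finBlW_box (hq : ∀ i, Quasiexact (P i))
    (hbot : {i : ι | ¬ ∃ b : P i, ∀ y : P i, b ≤ y}.Finite) (x : ∀ i, P i) :
    ∃ T : ∀ i, Set (P i), (∀ i, T i ∈ finBlW (x i)) ∧ {i | ¬ IsBotSingleton (T i)}.Finite := by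
  have hT : ∀ i, ∃ S ∈ finBlW (x i), (∃ b : P i, ∀ y : P i, b ≤ y) → IsBotSingleton S := by
    intro i
    by_cases h : ∃ b : P i, ∀ y : P i, b ≤ y
    · obtain ⟨b, hb⟩ := h
      exact ⟨{b}, singleton_mem_finBlW_of_isBot hb _, fun _ => ⟨b, rfl, hb⟩⟩
    · obtain ⟨S, hS⟩ := (hq i).finBlW_nonempty (x i)
      exact ⟨S, hS, fun h' => (h h').elim⟩
  choose T hT hTbot using hT
  exact ⟨T, hT, hbot.subset fun i hi hb => hi (hTbot i hb)⟩

theorem le_of_forall_finBlWBoxes (hq : ∀ i, Quasiexact (P i))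
    (hbot : {i : ι | ¬ ∃ b : P i, ∀ y : P i, b ≤ y}.Finite) {x y : ∀ i, P i}
    (hy : ∀ S ∈ finBlWBoxes x, y ∈ upSet S) : x ≤ y := by
  classical
  intro i
  obtain ⟨T, hT, hJ⟩ := exists_finBlW_box hq hbot x
  refine (hq i).le_of_forall_finBlW fun F hF => ?_
  have hmem : univ.pi (Function.update T i F) ∈ finBlWBoxes x := by
    refine ⟨_, fun j => ?_, (hJ.insert i).subset fun j hj => ?_, rfl⟩
    · obtain rfl | hji := eq_or_ne j i
      · simpa using hF
      · simpa [hji] using hT j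
    · obtain rfl | hji := eq_or_ne j i
      · exact mem_insert j _
      · exact mem_insert_of_mem i (by simpa [hji] using hj)
  simpa using mem_upSet_univ_pi.1 (hy _ hmem) i

end Boxes

/-- A product of quasiexact dcpos, all but finitely many of which
have a least element, is a quasiexact dcpo. -/
theorem product_of_quasiexact_dcpos_is_quasiexact {ι : Type*} (P : ι → Type*)
    [∀ i, PartialOrder (P i)] (hd : ∀ i, IsDcpo (P i)) (hq : ∀ i, Quasiexact (P i))
    (hbot : {i : ι | ¬ ∃ b : P i, ∀ y : P i, b ≤ y}.Finite) :
    IsDcpo (∀ i, P i) ∧ Quasiexact (∀ i, P i) := by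
  refine ⟨IsDcpo.pi hd, quasiexact_of_forall_exists_directedFam (IsDcpo.pi hd) fun x =>
    ⟨finBlWBoxes x, finBlWBoxes_subset_finBlW x, ?_, directedFam_finBlWBoxes hq x,
      fun y hy => le_of_forall_finBlWBoxes hq hbot hy⟩⟩
  obtain ⟨T, hT, hJ⟩ := exists_finBlW_box hq hbot x
  exact ⟨_, T, hT, hJ, rfl⟩
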